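/- arXiv:1211.2977 — 2 statements merged into one kernel-verified Lean document; each statement's English description precedes it below -/
import Mathlib

section
/- (Big Picard via Little Picard, punctured-ball version in the plane) If f : D \ {0} → ℂ is holomorphic with an essential singularity at 0, then f omits at most one value of ℂ; moreover every non-omitted value, with at most one exception, is attained infinitely often, i.e. f⁻¹(w) is infinite for all w ∈ ℂ with at most one exception. -/
open Filter Topology Set

/-- local Bloch -/
lemma bloch_local (F : ℂ → ℂ) (a : ℂ) (r : ℝ) (hr : 0 < r)
    (hF : DifferentiableOn ℂ F (Metric.ball a r)) (hne : deriv F a ≠ 0)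
    (hb : ∀ z ∈ Metric.ball a r, ‖deriv F z‖ ≤ 2 * ‖deriv F a‖) :
    Metric.ball (F a) (‖deriv F a‖ * r / 32) ⊆ F '' Metric.ball a r := by
  set m := ‖deriv F a‖ with hm
  have hmpos : 0 < m := norm_pos_iff.2 hne
  have hdF : DifferentiableOn ℂ (deriv F) (Metric.ball a r) := hF.deriv Metric.isOpen_ball
  have h1 : ∀ z ∈ Metric.ball a r, dist (deriv F z) (deriv F a) ≤ 3 * m / r * dist z a := by
    intro z hz
    refine Complex.dist_le_div_mul_dist_of_mapsTo_ball hdF ?_ hz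
    intro w hw
    rw [Metric.mem_closedBall, dist_eq_norm]
    have := norm_sub_le (deriv F w) (deriv F a)
    have := hb w hw
    linarith
  have hsub : Metric.closedBall a (r/8) ⊆ Metric.ball a r :=
    Metric.closedBall_subset_ball (by linarith)
  have hdiff : ∀ z ∈ Metric.ball a r, HasDerivAt F (deriv F z) z := fun z hz =>
    (hF.differentiableAt (Metric.isOpen_ball.mem_nhds hz)).hasDerivAt
  have h2 : ∀ z ∈ Metric.closedBall a (r/8),
      ‖(F z - deriv F a * z) - (F a - deriv F a * a)‖ ≤ (3 * m / 8) * ‖z - a‖ := by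
    intro z hz
    refine (convex_closedBall a (r/8)).norm_image_sub_le_of_norm_hasDerivWithin_le
      (f := fun z => F z - deriv F a * z) (f' := fun z => deriv F z - deriv F a) ?_ ?_
      (Metric.mem_closedBall_self (by linarith)) hz
    · intro x hx
      have := (hdiff x (hsub hx)).sub ((hasDerivAt_id x).const_mul (deriv F a))
      simp only [mul_one] at this
      exact this.hasDerivWithinAt
    · intro x hx
      have h := h1 x (hsub hx)
      rw [dist_eq_norm] at h
      refine h.trans ?_
      have hx' : dist x a ≤ r/8 := hx
      calc 3 * m / r * dist x a ≤ 3 * m / r * (r/8) := by gcongr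
        _ = 3 * m / 8 := by field_simp
  have h3 : ∀ z ∈ Metric.sphere a (r/8), m * r / 16 ≤ ‖F z - F a‖ := by
    intro z hz
    have h := h2 z (Metric.sphere_subset_closedBall hz)
    have hz' : ‖z - a‖ = r/8 := by rw [← dist_eq_norm]; exact hz
    have h4 : ‖deriv F a * (z - a)‖ = m * (r/8) := by rw [norm_mul, hz']
    have h5 : deriv F a * (z - a) = (F z - F a) -
      ((F z - deriv F a * z) - (F a - deriv F a * a)) := by ring
    have h6 := norm_sub_le (F z - F a) ((F z - deriv F a * z) - (F a - deriv F a * a))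
    rw [← h5, h4] at h6
    rw [hz'] at h
    nlinarith [mul_pos hmpos hr]
  have hfreq : ∃ᶠ z in 𝓝 a, F z ≠ F a := by
    intro hcon
    have : F =ᶠ[𝓝 a] fun _ => F a := by
      filter_upwards [hcon] with z hz
      simpa using hz
    exact hne (by rw [this.deriv_eq]; simp)
  have h7 := DiffContOnCl.ball_subset_image_closedBall
    (f := F) (z₀ := a) (r := r/8) (ε := m * r / 16)
    (DifferentiableOn.diffContOnCl_ball hF hsub) (by linarith) h3 hfreq
  intro w hw
  have : w ∈ F '' Metric.closedBall a (r/8) := h7 (by rwa [show m * r / 16 / 2 = m * r / 32 by ring])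
  exact image_mono hsub this

lemma bloch (F : ℂ → ℂ) (c : ℂ) (R : ℝ) (hR : 0 < R)
    (hF : DifferentiableOn ℂ F (Metric.ball c R)) (hne : deriv F c ≠ 0) :
    ∃ p, Metric.ball p (‖deriv F c‖ * R / 128) ⊆ F '' Metric.ball c R := by
  set S := R / 2 with hS
  have hSpos : 0 < S := by positivity
  have hsub : Metric.closedBall c S ⊆ Metric.ball c R :=
    Metric.closedBall_subset_ball (by rw [hS]; linarith)
  have hdF : DifferentiableOn ℂ (deriv F) (Metric.ball c R) := hF.deriv Metric.isOpen_ball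
  have hcont : ContinuousOn (fun z => ‖deriv F z‖ * (S - dist z c)) (Metric.closedBall c S) := by
    have := (hdF.continuousOn.mono hsub).norm
    fun_prop
  obtain ⟨p, hp, hmax⟩ := (isCompact_closedBall c S).exists_isMaxOn
    ⟨c, Metric.mem_closedBall_self hSpos.le⟩ hcont
  have hmax' : ∀ z ∈ Metric.closedBall c S,
    ‖deriv F z‖ * (S - dist z c) ≤ ‖deriv F p‖ * (S - dist p c) := fun z hz => hmax hz
  have h0 := hmax' c (Metric.mem_closedBall_self hSpos.le)
  rw [dist_self, sub_zero] at h0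
  have hmpos : 0 < ‖deriv F c‖ := norm_pos_iff.2 hne
  have hpos : 0 < ‖deriv F p‖ * (S - dist p c) := lt_of_lt_of_le (by positivity) h0
  have hp' : dist p c ≤ S := hp
  have hpd : 0 < ‖deriv F p‖ := by
    rcases (norm_nonneg (deriv F p)).eq_or_lt with h | h
    · rw [← h] at hpos; simp at hpos
    · exact h
  have hsd : 0 < S - dist p c := (pos_iff_pos_of_mul_pos hpos).1 hpd
  set r := (S - dist p c) / 2 with hr
  have hrpos : 0 < r := by positivity
  have hballs : ∀ z ∈ Metric.ball p r, r ≤ S - dist z c := by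
    intro z hz
    have h1 : dist z p < r := hz
    have h2 := dist_triangle z p c
    linarith
  have hsub2 : Metric.ball p r ⊆ Metric.closedBall c S := by
    intro z hz
    have := hballs z hz
    rw [Metric.mem_closedBall]; linarith
  have := bloch_local F p r hrpos (hF.mono (hsub2.trans hsub)) (norm_pos_iff.1 hpd) (by
    intro z hz
    have h1 := hmax' z (hsub2 hz)
    have h2 := hballs z hz
    have h3 : ‖deriv F z‖ * r ≤ ‖deriv F p‖ * (S - dist p c) :=
      (mul_le_mul_of_nonneg_left h2 (norm_nonneg _)).trans h1
    have h4 : S - dist p c = 2 * r := by rw [hr]; ring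
    rw [h4] at h3
    have : ‖deriv F z‖ * r ≤ (2 * ‖deriv F p‖) * r := by linarith
    exact le_of_mul_le_mul_right this hrpos)
  refine ⟨F p, fun w hw => image_mono (hsub2.trans hsub) (this (Metric.ball_subset_ball ?_ hw))⟩
  have h4 : S - dist p c = 2 * r := by rw [hr]; ring
  rw [h4] at h0
  nlinarith

lemma deriv_bound (F : ℂ → ℂ) (c : ℂ) (R : ℝ) (hR : 0 < R)
    (hF : DifferentiableOn ℂ F (Metric.ball c R)) (E : Set ℂ)
    (hE : ∀ w : ℂ, ∃ e ∈ E, dist e w < 4) (hom : ∀ z ∈ Metric.ball c R, F z ∉ E) :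
    ‖deriv F c‖ ≤ 512 / R := by
  by_contra hcon
  push Not at hcon
  have hne : deriv F c ≠ 0 := norm_pos_iff.1 (lt_trans (by positivity) hcon)
  obtain ⟨p, hp⟩ := bloch F c R hR hF hne
  obtain ⟨e, heE, he⟩ := hE p
  rw [div_lt_iff₀ hR] at hcon
  obtain ⟨z, hz, rfl⟩ := hp (show e ∈ Metric.ball p _ by rw [Metric.mem_ball]; linarith)
  exact hom z hz heE

lemma log_lift (f : ℂ → ℂ) (c : ℂ) (R : ℝ) (hR : 0 < R)
    (hf : DifferentiableOn ℂ f (Metric.ball c R)) (h0 : ∀ z ∈ Metric.ball c R, f z ≠ 0) :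
    ∃ L : ℂ → ℂ, DifferentiableOn ℂ L (Metric.ball c R) ∧
      ∀ z ∈ Metric.ball c R, f z = Complex.exp (L z) := by
  obtain ⟨P, hP⟩ := ((hf.deriv Metric.isOpen_ball).div hf h0).isExactOn_ball
  have hfd : ∀ z ∈ Metric.ball c R, HasDerivAt f (deriv f z) z := fun z hz =>
    (hf.differentiableAt (Metric.isOpen_ball.mem_nhds hz)).hasDerivAt
  have hc : c ∈ Metric.ball c R := Metric.mem_ball_self hR
  have hd : ∀ z ∈ Metric.ball c R, HasDerivAt (fun z => f z * Complex.exp (-P z)) 0 z := by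
    intro z hz
    have := (hfd z hz).mul ((hP z hz).neg.cexp)
    refine this.congr_deriv ?_
    have := h0 z hz
    simp only [Pi.div_apply]
    field_simp
    ring
  have hconst : ∀ z ∈ Metric.ball c R, f z * Complex.exp (-P z) = f c * Complex.exp (-P c) := by
    intro z hz
    have := (convex_ball c R).norm_image_sub_le_of_norm_hasDerivWithin_le (C := 0)
      (f := fun z => f z * Complex.exp (-P z)) (f' := fun _ => 0)
      (fun x hx => (hd x hx).hasDerivWithinAt) (by simp) hc hz
    simpa [sub_eq_zero] using this
  refine ⟨fun z => P z + (Complex.log (f c) - P c), ?_, ?_⟩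
  · intro z hz
    exact ((hP z hz).differentiableAt.add_const _).differentiableWithinAt
  · intro z hz
    have h := hconst z hz
    rw [Complex.exp_add, Complex.exp_sub, Complex.exp_log (h0 c hc)]
    rw [Complex.exp_neg, Complex.exp_neg] at h
    have h1 := Complex.exp_ne_zero (P z)
    have h2 := Complex.exp_ne_zero (P c)
    field_simp at h ⊢
    linear_combination h

lemma im_le_cos (w : ℂ) : |w.im| ≤ ‖Complex.cos w‖ := by
  have h := Complex.cos_eq w
  have hre : (Complex.cos w).re = Real.cos w.re * Real.cosh w.im := by
    rw [h]; simp [← Complex.ofReal_cos, ← Complex.ofReal_cosh, ← Complex.ofReal_sin, ← Complex.ofReal_sinh]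
  have him : (Complex.cos w).im = - (Real.sin w.re * Real.sinh w.im) := by
    rw [h]; simp [← Complex.ofReal_cos, ← Complex.ofReal_cosh, ← Complex.ofReal_sin, ← Complex.ofReal_sinh]
  have h1 : |w.im| ≤ |Real.sinh w.im| := by
    rw [Real.abs_sinh]
    exact Real.self_le_sinh_iff.2 (abs_nonneg _)
  refine h1.trans ?_
  refine abs_le_of_sq_le_sq ?_ (norm_nonneg _)
  rw [← Complex.normSq_eq_norm_sq, Complex.normSq_apply, hre, him]
  nlinarith [Real.sin_sq_add_cos_sq w.re, Real.cosh_sq w.im, sq_nonneg (Real.cos w.re), sq_nonneg (Real.sinh w.im)]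

lemma cos_lift (f : ℂ → ℂ) (c : ℂ) (R : ℝ) (hR : 0 < R)
    (hf : DifferentiableOn ℂ f (Metric.ball c R)) (h0 : ∀ z ∈ Metric.ball c R, f z ≠ 1)
    (h0' : ∀ z ∈ Metric.ball c R, f z ≠ -1) :
    ∃ F : ℂ → ℂ, DifferentiableOn ℂ F (Metric.ball c R) ∧
      (∀ z ∈ Metric.ball c R, f z = Complex.cos (F z)) ∧ ‖F c‖ ≤ Real.pi + ‖f c‖ := by
  have hc : c ∈ Metric.ball c R := Metric.mem_ball_self hR
  obtain ⟨L, hL, hLe⟩ := log_lift (fun z => f z ^ 2 - 1) c R hR (by fun_prop) (by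
    intro z hz h
    have : (f z - 1) * (f z + 1) = 0 := by linear_combination h
    rcases mul_eq_zero.1 this with h | h
    · exact h0 z hz (sub_eq_zero.1 h)
    · exact h0' z hz (eq_neg_of_add_eq_zero_left h))
  set s : ℂ → ℂ := fun z => Complex.exp (L z / 2) with hs
  have hs2 : ∀ z ∈ Metric.ball c R, s z ^ 2 = f z ^ 2 - 1 := by
    intro z hz
    rw [hLe z hz, hs, ← Complex.exp_nat_mul]
    congr 1; push_cast; ring
  have hsd : DifferentiableOn ℂ s (Metric.ball c R) := by
    rw [hs]; fun_prop
  have hmul : ∀ z ∈ Metric.ball c R, (f z + s z) * (f z - s z) = 1 := by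
    intro z hz
    linear_combination - hs2 z hz
  obtain ⟨K, hK, hKe⟩ := log_lift (fun z => f z + s z) c R hR (hf.add hsd) (by
    intro z hz h
    have := hmul z hz
    have h' : f z + s z = 0 := h
    rw [h'] at this; simp at this)
  obtain ⟨k, hk⟩ : ∃ k : ℤ, |(K c / Complex.I).re - k * (2 * Real.pi)| ≤ Real.pi := by
    refine ⟨round ((K c / Complex.I).re / (2 * Real.pi)), ?_⟩
    have h := abs_sub_round ((K c / Complex.I).re / (2 * Real.pi))
    have hpi := Real.pi_pos
    set x := (K c / Complex.I).re
    have : x - round (x / (2 * Real.pi)) * (2 * Real.pi) =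
      (x / (2 * Real.pi) - round (x / (2 * Real.pi))) * (2 * Real.pi) := by field_simp
    rw [this, abs_mul, abs_of_pos (by positivity : 0 < 2 * Real.pi)]
    nlinarith
  have hcos : ∀ z ∈ Metric.ball c R,
      f z = Complex.cos (K z / Complex.I - k * (2 * Real.pi)) := by
    intro z hz
    rw [Complex.cos_sub_int_mul_two_pi, Complex.cos]
    have e1 : K z / Complex.I * Complex.I = K z := by field_simp
    have e2 : -(K z / Complex.I) * Complex.I = - K z := by field_simp
    rw [e1, e2, Complex.exp_neg, ← hKe z hz]
    have h := hmul z hz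
    rw [inv_eq_of_mul_eq_one_right h]
    ring
  refine ⟨fun z => K z / Complex.I - k * (2 * Real.pi), by fun_prop, hcos, ?_⟩
  refine (Complex.norm_le_abs_re_add_abs_im _).trans ?_
  refine add_le_add ?_ ?_
  · have : (K c / Complex.I - k * (2 * Real.pi)).re
        = (K c / Complex.I).re - k * (2 * Real.pi) := by
      simp [Complex.sub_re, Complex.mul_re]
    rw [this]; exact hk
  · refine (im_le_cos _).trans_eq ?_
    rw [← hcos c hc]

lemma cosh_net (t : ℝ) (ht : 0 ≤ t) : ∃ y ∈ Icc t (t+2), ∃ n : ℤ, Real.cosh y = n := by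
  have h2 : 2 ≤ Real.cosh 2 := by
    rw [Real.cosh_eq]
    have h1 : (2:ℝ) + 1 ≤ Real.exp 2 := Real.add_one_le_exp 2
    have h3 : (1:ℝ) + 1 ≤ Real.exp 1 := Real.add_one_le_exp 1
    have h4 : Real.exp 2 = Real.exp 1 * Real.exp 1 := by rw [← Real.exp_add]; norm_num
    have := Real.exp_pos (-2)
    nlinarith
  have h1 := Real.one_le_cosh t
  have h : Real.cosh t + 1 ≤ Real.cosh (t + 2) := by
    rw [Real.cosh_add]
    have := Real.sinh_nonneg_iff.2 ht
    have : 0 ≤ Real.sinh 2 := Real.sinh_nonneg_iff.2 (by norm_num)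
    nlinarith [mul_nonneg ‹0 ≤ Real.sinh t› this]
  have hn : ((⌈Real.cosh t⌉ : ℤ) : ℝ) ∈ Icc (Real.cosh t) (Real.cosh (t+2)) :=
    ⟨Int.le_ceil _, (Int.ceil_lt_add_one _).le.trans h⟩
  obtain ⟨y, hy, hy'⟩ := intermediate_value_Icc (by linarith) Real.continuous_cosh.continuousOn hn
  exact ⟨y, hy, _, hy'⟩

lemma cos_net (w : ℂ) : ∃ e ∈ {e : ℂ | ∃ n : ℤ, Complex.cos e = n}, dist e w < 4 := by
  obtain ⟨y, hy, n, hn⟩ := cosh_net |w.im| (abs_nonneg _)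
  obtain ⟨y', hy', hn'⟩ : ∃ y' : ℝ, |y' - w.im| ≤ 2 ∧ Real.cosh y' = n := by
    rcases le_total 0 w.im with h | h
    · rw [abs_of_nonneg h] at hy
      exact ⟨y, abs_le.2 ⟨by linarith [hy.1], by linarith [hy.2]⟩, hn⟩
    · rw [abs_of_nonpos h] at hy
      exact ⟨-y, abs_le.2 ⟨by linarith [hy.2], by linarith [hy.1]⟩, by rw [Real.cosh_neg]; exact hn⟩
  set m := round (w.re / Real.pi) with hm
  have hpi := Real.pi_pos
  have hre : |m * Real.pi - w.re| ≤ Real.pi / 2 := by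
    have h := abs_sub_round (w.re / Real.pi)
    have e : m * Real.pi - w.re = - ((w.re / Real.pi - m) * Real.pi) := by field_simp; ring
    rw [e, abs_neg, abs_mul, abs_of_pos hpi]
    nlinarith
  obtain ⟨s, hs⟩ : ∃ s : ℤ, Real.cos (m * Real.pi) = s := by
    rcases abs_eq (zero_le_one) |>.1 (Real.abs_cos_int_mul_pi m) with h | h
    · exact ⟨1, by simpa using h⟩
    · exact ⟨-1, by simpa using h⟩
  refine ⟨⟨m * Real.pi, y'⟩, ⟨s * n, ?_⟩, ?_⟩
  · rw [Complex.cos_eq]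
    have e1 : Complex.sin ((m * Real.pi : ℝ) : ℂ) = 0 := by
      rw [← Complex.ofReal_sin, Real.sin_int_mul_pi]; simp
    have e2 : Complex.cos ((m * Real.pi : ℝ) : ℂ) = s := by
      rw [← Complex.ofReal_cos, hs]; simp
    have e3 : Complex.cosh ((y' : ℝ) : ℂ) = n := by
      rw [← Complex.ofReal_cosh, hn']; simp
    simp only [e1, e2, e3]
    push_cast
    ring
  · rw [dist_eq_norm]
    refine (Complex.norm_le_abs_re_add_abs_im _).trans_lt ?_
    simp only [Complex.sub_re, Complex.sub_im]
    have := Real.pi_lt_four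
    linarith

lemma norm_cos_le (w : ℂ) : ‖Complex.cos w‖ ≤ Real.exp ‖w‖ := by
  rw [Complex.cos, norm_div]
  have h1 := Complex.norm_exp_le_exp_norm (w * Complex.I)
  have h2 := Complex.norm_exp_le_exp_norm (-w * Complex.I)
  have h3 := norm_add_le (Complex.exp (w * Complex.I)) (Complex.exp (-w * Complex.I))
  simp only [norm_mul, norm_neg, Complex.norm_I, mul_one] at h1 h2
  rw [Complex.norm_ofNat]
  linarith

/-- A Schottky-type theorem. -/
lemma schottky (M : ℝ) : ∃ C : ℝ, ∀ (c : ℂ) (h : ℂ → ℂ),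
    DifferentiableOn ℂ h (Metric.ball c 600) → (∀ z ∈ Metric.ball c 600, h z ≠ 0) →
    (∀ z ∈ Metric.ball c 600, h z ≠ 1) → ‖h c‖ ≤ M →
    ∀ z ∈ Metric.closedBall c 10, ‖h z‖ ≤ C := by
  refine ⟨(Real.exp (Real.pi * Real.exp (Real.pi + (Real.pi + (2 * M + 1)) + 100)) + 1) / 2, ?_⟩
  intro c h hd h0 h1 hM z hz
  have hpi := Real.pi_pos
  have hpi3 := Real.pi_gt_three
  have hc : c ∈ Metric.ball c (600:ℝ) := Metric.mem_ball_self (by norm_num)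
  obtain ⟨F, hF, hFe, hFc⟩ := cos_lift (fun z => 2 * h z - 1) c 600 (by norm_num) (by fun_prop)
    (fun z hz e => h1 z hz (by linear_combination e / 2))
    (fun z hz e => h0 z hz (by linear_combination e / 2))
  have hFom : ∀ z ∈ Metric.ball c (600:ℝ), ∀ n : ℤ, F z / Real.pi ≠ n := by
    intro z hz n e
    have hpi' : (Real.pi : ℂ) ≠ 0 := by exact_mod_cast hpi.ne'
    have e' : F z = ((n * Real.pi : ℝ) : ℂ) := by
      rw [div_eq_iff hpi'] at e; rw [e]; push_cast; ring
    have e3 := hFe z hz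
    rw [e', ← Complex.ofReal_cos] at e3
    rcases abs_eq (zero_le_one) |>.1 (Real.abs_cos_int_mul_pi n) with h | h
    · rw [h] at e3; push_cast at e3; exact h1 z hz (by linear_combination e3 / 2)
    · rw [h] at e3; push_cast at e3; exact h0 z hz (by linear_combination e3 / 2)
  obtain ⟨G, hG, hGe, hGc⟩ := cos_lift (fun z => F z / Real.pi) c 600 (by norm_num) (by fun_prop)
    (fun z hz e => hFom z hz 1 (by simpa using e)) (fun z hz e => hFom z hz (-1) (by simpa using e))
  have hGd : ∀ z ∈ Metric.closedBall c (10:ℝ), ‖deriv G z‖ ≤ 10 := by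
    intro z hz
    have hsub : Metric.ball z 500 ⊆ Metric.ball c 600 :=
      Metric.ball_subset_ball' (by have : dist z c ≤ 10 := hz; linarith)
    refine (deriv_bound G z 500 (by norm_num) (hG.mono hsub) _ cos_net ?_).trans (by norm_num)
    rintro x hx ⟨n, hn⟩
    exact hFom x (hsub hx) n ((hGe x (hsub hx)).trans hn)
  have hsub : Metric.closedBall c (10:ℝ) ⊆ Metric.ball c 600 :=
    Metric.closedBall_subset_ball (by norm_num)
  have hGz : ‖G z - G c‖ ≤ 10 * ‖z - c‖ :=
    (convex_closedBall c (10:ℝ)).norm_image_sub_le_of_norm_deriv_le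
      (fun x hx => hG.differentiableAt (Metric.isOpen_ball.mem_nhds (hsub hx))) hGd
      (Metric.mem_closedBall_self (by norm_num)) hz
  have hz' : ‖z - c‖ ≤ 10 := by rw [← dist_eq_norm]; exact hz
  have hFc' : ‖F c‖ ≤ Real.pi + (2 * M + 1) := by
    refine hFc.trans ?_
    have := norm_sub_le (2 * h c) 1
    rw [norm_mul, Complex.norm_ofNat, norm_one] at this
    linarith
  have hn : ∀ z, ‖F z / Real.pi‖ = ‖F z‖ / Real.pi := by
    intro z; rw [norm_div, Complex.norm_real, Real.norm_of_nonneg hpi.le]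
  have hGc' : ‖G c‖ ≤ Real.pi + (Real.pi + (2 * M + 1)) := by
    refine hGc.trans ?_
    rw [hn]
    have : ‖F c‖ / Real.pi ≤ ‖F c‖ := div_le_self (norm_nonneg _) (by linarith)
    linarith
  have hGz' : ‖G z‖ ≤ Real.pi + (Real.pi + (2 * M + 1)) + 100 := by
    have : ‖G z‖ ≤ ‖G z - G c‖ + ‖G c‖ := by simpa using norm_add_le (G z - G c) (G c)
    linarith
  have hFz : ‖F z‖ ≤ Real.pi * Real.exp (Real.pi + (Real.pi + (2 * M + 1)) + 100) := by
    have h2 := (norm_cos_le (G z)).trans (Real.exp_le_exp.2 hGz')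
    rw [← hGe z (hsub hz), hn, div_le_iff₀ hpi] at h2
    linarith
  have h3 := (norm_cos_le (F z)).trans (Real.exp_le_exp.2 hFz)
  rw [← hFe z (hsub hz)] at h3
  have h4 : ‖2 * h z‖ ≤ ‖2 * h z - 1‖ + ‖(1:ℂ)‖ := by
    simpa using norm_add_le (2 * h z - 1) 1
  rw [norm_mul, Complex.norm_ofNat, norm_one] at h4
  linarith

lemma circle_bound (M : ℝ) : ∃ C : ℝ, ∀ (g : ℂ → ℂ) (r : ℝ),
    DifferentiableOn ℂ g (Metric.ball 0 r \ {0}) →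
    (∀ z ∈ Metric.ball (0:ℂ) r \ {0}, g z ≠ 0) → (∀ z ∈ Metric.ball (0:ℂ) r \ {0}, g z ≠ 1) →
    ∀ z, z ≠ 0 → ‖z‖ * Real.exp 600 < r → ‖g z‖ ≤ M → ∀ ζ, ‖ζ‖ = ‖z‖ → ‖g ζ‖ ≤ C := by
  obtain ⟨C, hC⟩ := schottky M
  refine ⟨C, fun g r hg h0 h1 z hz hzr hgz ζ hζ => ?_⟩
  have hζ0 : ζ ≠ 0 := by rw [← norm_pos_iff, hζ]; exact norm_pos_iff.2 hz
  have hmaps : MapsTo Complex.exp (Metric.ball (Complex.log z) 600) (Metric.ball 0 r \ {0}) := by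
    intro x hx
    refine ⟨?_, Complex.exp_ne_zero x⟩
    rw [mem_ball_zero_iff, Complex.norm_exp]
    refine lt_trans ?_ hzr
    have h2 : ‖z‖ = Real.exp (Complex.log z).re := by
      rw [← Complex.norm_exp, Complex.exp_log hz]
    rw [h2, ← Real.exp_add]
    refine Real.exp_lt_exp.2 ?_
    have h3 := (Complex.abs_re_le_norm (x - Complex.log z))
    rw [Metric.mem_ball, dist_eq_norm] at hx
    have h4 := (le_abs_self _).trans h3
    rw [Complex.sub_re] at h4
    linarith
  have := hC (Complex.log z) (g ∘ Complex.exp)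
    (hg.comp Complex.differentiable_exp.differentiableOn hmaps)
    (fun x hx => h0 _ (hmaps hx)) (fun x hx => h1 _ (hmaps hx))
    (by simpa [Complex.exp_log hz] using hgz) (Complex.log ζ) ?_
  · simpa [Complex.exp_log hζ0] using this
  · rw [Metric.mem_closedBall, dist_eq_norm]
    refine (Complex.norm_le_abs_re_add_abs_im _).trans ?_
    rw [Complex.sub_re, Complex.sub_im, Complex.log_re, Complex.log_re, hζ, sub_self, abs_zero,
      zero_add, Complex.log_im, Complex.log_im]
    have a1 := Complex.abs_arg_le_pi z
    have a2 := Complex.abs_arg_le_pi ζ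
    have a3 := abs_sub (Complex.arg ζ) (Complex.arg z)
    have := Real.pi_lt_four
    rw [abs_le] at *
    constructor <;> linarith [Real.pi_lt_d2]

lemma picard_aux (g : ℂ → ℂ) (r : ℝ) (hr : 0 < r)
    (hg : DifferentiableOn ℂ g (Metric.ball 0 r \ {0}))
    (h0 : ∀ z ∈ Metric.ball (0:ℂ) r \ {0}, g z ≠ 0)
    (h1 : ∀ z ∈ Metric.ball (0:ℂ) r \ {0}, g z ≠ 1) :
    Tendsto g (𝓝[≠] 0) (cocompact ℂ) ∨ ∃ l, Tendsto g (𝓝[≠] 0) (𝓝 l) := by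
  by_cases hinf : Tendsto g (𝓝[≠] 0) (cocompact ℂ)
  · exact Or.inl hinf
  right
  rw [← Metric.cobounded_eq_cocompact, ← tendsto_norm_atTop_iff_cobounded, tendsto_atTop] at hinf
  push Not at hinf
  obtain ⟨M, hM⟩ := hinf
  obtain ⟨C, hC⟩ := circle_bound M
  have key : ∀ ε > 0, ∃ z : ℂ, z ≠ 0 ∧ ‖z‖ < ε ∧ ‖z‖ * Real.exp 600 < r ∧
      ∀ ζ, ‖ζ‖ = ‖z‖ → ‖g ζ‖ ≤ C := by
    intro ε hε
    have hδ : 0 < min ε (r / Real.exp 600) := by positivity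
    have hev : ∀ᶠ z in 𝓝[≠] (0:ℂ), z ∈ Metric.ball (0:ℂ) (min ε (r / Real.exp 600)) ∧ z ≠ 0 :=
      Filter.inter_mem (nhdsWithin_le_nhds (Metric.ball_mem_nhds _ hδ)) self_mem_nhdsWithin
    obtain ⟨z, hz, hz', hz0⟩ := (hM.and_eventually hev).exists
    rw [mem_ball_zero_iff, lt_min_iff, lt_div_iff₀ (Real.exp_pos _)] at hz'
    exact ⟨z, hz0, hz'.1, hz'.2, hC g r hg h0 h1 z hz0 hz'.2 (le_of_lt (by simpa using hz))⟩
  obtain ⟨z₀, hz₀, -, hz₀r, hz₀C⟩ := key 1 one_pos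
  have hz₀r' : ‖z₀‖ < r := by
    refine lt_of_le_of_lt ?_ hz₀r
    exact le_mul_of_one_le_right (norm_nonneg _) (Real.one_le_exp (by norm_num))
  have hbd : ∀ ζ : ℂ, ζ ≠ 0 → ‖ζ‖ < ‖z₀‖ → ‖g ζ‖ ≤ C := by
    intro ζ hζ hζz
    obtain ⟨z₁, hz₁, hz₁ζ, -, hz₁C⟩ := key ‖ζ‖ (norm_pos_iff.2 hζ)
    set U : Set ℂ := {w | ‖z₁‖ < ‖w‖ ∧ ‖w‖ < ‖z₀‖} with hU
    have hcl : closure U ⊆ {w | ‖z₁‖ ≤ ‖w‖ ∧ ‖w‖ ≤ ‖z₀‖} := by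
      refine closure_minimal (fun w hw => ⟨hw.1.le, hw.2.le⟩) ?_
      exact (isClosed_le continuous_const continuous_norm).inter
        (isClosed_le continuous_norm continuous_const)
    have hUo : IsOpen U := (isOpen_lt continuous_const continuous_norm).inter
        (isOpen_lt continuous_norm continuous_const)
    have hclsub : closure U ⊆ Metric.ball 0 r \ {0} := by
      intro w hw
      obtain ⟨a, b⟩ := hcl hw
      refine ⟨by rw [mem_ball_zero_iff]; linarith, ?_⟩
      intro hw0
      rw [mem_singleton_iff] at hw0
      rw [hw0, norm_zero] at a
      exact hz₁ (norm_le_zero_iff.1 a)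
    refine Complex.norm_le_of_forall_mem_frontier_norm_le (U := U) ?_
      (hg.mono hclsub).diffContOnCl ?_ (subset_closure ⟨hz₁ζ, hζz⟩)
    · refine (Metric.isBounded_ball (x := (0:ℂ)) (r := ‖z₀‖)).subset ?_
      intro w hw
      rw [mem_ball_zero_iff]; exact hw.2
    · intro w hw
      rw [hUo.frontier_eq] at hw
      obtain ⟨a, b⟩ := hcl hw.1
      rcases a.eq_or_lt with h | h
      · exact hz₁C w h.symm
      · rcases b.eq_or_lt with h' | h'
        · exact hz₀C w h'
        · exact absurd ⟨h, h'⟩ hw.2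
  have hz₀p := norm_pos_iff.2 hz₀
  refine ⟨_, Complex.tendsto_limUnder_of_differentiable_on_punctured_nhds_of_bounded_under ?_ ?_⟩
  · filter_upwards [nhdsWithin_le_nhds (Metric.ball_mem_nhds (0:ℂ) hr), self_mem_nhdsWithin]
      with z hz hz0
    exact hg.differentiableAt ((Metric.isOpen_ball.sdiff isClosed_singleton).mem_nhds ⟨hz, hz0⟩)
  · refine ⟨C + ‖g 0‖, ?_⟩
    rw [eventually_map]
    filter_upwards [nhdsWithin_le_nhds (Metric.ball_mem_nhds (0:ℂ) hz₀p), self_mem_nhdsWithin]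
      with z hz hz0
    have := hbd z hz0 (by simpa using hz)
    exact (norm_sub_le _ _).trans (by linarith)

theorem great_picard_punctured_disk
    (f : ℂ → ℂ)
    (hf : DifferentiableOn ℂ f (Metric.ball (0 : ℂ) 1 \ {0}))
    (hess : ¬ ∃ L : OnePoint ℂ,
      Tendsto (fun z => ((f z : ℂ) : OnePoint ℂ)) (𝓝[Metric.ball (0 : ℂ) 1 \ {0}] 0) (𝓝 L)) :
    ∃ w₀ : ℂ, ∀ w : ℂ, w ≠ w₀ →
      Set.Infinite {z ∈ Metric.ball (0 : ℂ) 1 \ {0} | f z = w} := by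
  by_contra hcon
  push Not at hcon
  obtain ⟨a, -, ha⟩ := hcon 0
  obtain ⟨b, hba, hb⟩ := hcon a
  have hba' : b - a ≠ 0 := sub_ne_zero.2 hba
  set S := {z ∈ Metric.ball (0 : ℂ) 1 \ {0} | f z = a} ∪ {z ∈ Metric.ball (0 : ℂ) 1 \ {0} | f z = b}
    with hS
  have hSf : S.Finite := ha.union hb
  have h0S : (0:ℂ) ∉ S := by simp [hS]
  obtain ⟨r, hr, hrS⟩ := Metric.isOpen_iff.1 (hSf.isClosed.isOpen_compl.inter Metric.isOpen_ball) 0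
    ⟨h0S, Metric.mem_ball_self (zero_lt_one (α := ℝ))⟩
  have hsub : Metric.ball (0:ℂ) r \ {0} ⊆ Metric.ball (0:ℂ) 1 \ {0} :=
    fun z hz => ⟨(hrS hz.1).2, hz.2⟩
  have hfab : ∀ z ∈ Metric.ball (0:ℂ) r \ {0}, f z ≠ a ∧ f z ≠ b := fun z hz =>
    ⟨fun h => (hrS hz.1).1 (Or.inl ⟨hsub hz, h⟩), fun h => (hrS hz.1).1 (Or.inr ⟨hsub hz, h⟩)⟩
  have hle : 𝓝[Metric.ball (0 : ℂ) 1 \ {0}] 0 ≤ 𝓝[≠] (0:ℂ) :=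
    nhdsWithin_mono _ (fun z hz => hz.2)
  have hfg : f = fun z => (b - a) * ((f z - a) / (b - a)) + a := by
    funext z; field_simp; ring
  rcases picard_aux (fun z => (f z - a) / (b - a)) r hr (((hf.mono hsub).sub_const a).div_const _)
    (fun z hz h => by
      rw [div_eq_zero_iff] at h
      exact (hfab z hz).1 (sub_eq_zero.1 (h.resolve_right hba')))
    (fun z hz h => by
      rw [div_eq_one_iff_eq hba'] at h
      exact (hfab z hz).2 (by linear_combination h)) with h | ⟨l, h⟩
  · refine hess ⟨OnePoint.infty, ?_⟩
    have hcc : Tendsto f (𝓝[≠] 0) (cocompact ℂ) := by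
      rw [hfg]
      exact (((Homeomorph.mulLeft₀ (b - a) hba').trans (Homeomorph.addRight a)).isClosedEmbedding.tendsto_cocompact).comp h
    have h2 : Tendsto ((↑) : ℂ → OnePoint ℂ) (cocompact ℂ) (𝓝 OnePoint.infty) := by
      rw [← coclosedCompact_eq_cocompact]
      exact OnePoint.tendsto_coe_infty
    exact h2.comp (hcc.mono_left hle)
  · refine hess ⟨(((b - a) * l + a : ℂ) : OnePoint ℂ), ?_⟩
    have hcc : Tendsto f (𝓝[≠] 0) (𝓝 ((b - a) * l + a)) := by
      rw [hfg]
      exact (h.const_mul _).add_const _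
    exact ((OnePoint.continuous_coe).tendsto _).comp (hcc.mono_left hle)
end

section
/- (Zalcman rescaling for non-normal families of holomorphic functions) Let Ω ⊂ ℂ be a domain and F a family of holomorphic functions Ω → ℂ that is not normal at a point a ∈ Ω (with respect to the spherical metric). Then there exist sequences x_j → a in Ω, ρ_j → 0 in (0,∞), functions f_j ∈ F, and a non-constant entire function g : ℂ → ℂ ∪ {∞} (meromorphic) such that f_j(x_j + ρ_j v) → g(v) locally uniformly on ℂ in the spherical metric. -/
open Filter Topology Set OnePoint

/-- Chordal (spherical) distance on the Riemann sphere `ℂ ∪ {∞}`. -/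
noncomputable def sdist (u v : OnePoint ℂ) : ℝ :=
  match u, v with
  | Option.some z, Option.some w =>
      2 * dist z w / (Real.sqrt (1 + ‖z‖ ^ 2) * Real.sqrt (1 + ‖w‖ ^ 2))
  | Option.some z, Option.none => 2 / Real.sqrt (1 + ‖z‖ ^ 2)
  | Option.none, Option.some w => 2 / Real.sqrt (1 + ‖w‖ ^ 2)
  | Option.none, Option.none => 0

/-- A map to the Riemann sphere is meromorphic on `s`: near each point of `s` it is either
given by an analytic function, or it has a pole given as the reciprocal of an analytic
function vanishing at that point. -/
def MeromorphicToSphere (g : ℂ → OnePoint ℂ) (s : Set ℂ) : Prop :=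
  ∀ z ∈ s, ∃ h : ℂ → ℂ, AnalyticAt ℂ h z ∧
    ((∀ᶠ w in 𝓝 z, g w = ((h w : ℂ) : OnePoint ℂ)) ∨
     (g z = (∞ : OnePoint ℂ) ∧ h z = 0 ∧
       ∀ᶠ w in 𝓝[≠] z, g w = (((h w)⁻¹ : ℂ) : OnePoint ℂ)))


/-- stereographic embedding -/
noncomputable def sig (z : ℂ) : ℂ × ℝ :=
  (2 * z / (1 + ‖z‖ ^ 2 : ℝ), (‖z‖ ^ 2 - 1) / (1 + ‖z‖ ^ 2))

noncomputable def sigO (u : OnePoint ℂ) : ℂ × ℝ :=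
  match u with
  | Option.some z => sig z
  | Option.none => (0, 1)

lemma sigO_coe (z : ℂ) : sigO (z : OnePoint ℂ) = sig z := rfl
lemma sigO_inf : sigO (∞ : OnePoint ℂ) = (0, 1) := rfl

noncomputable def tau (x : ℂ × ℝ) : OnePoint ℂ :=
  open Classical in if x.2 = 1 then ∞ else ((x.1 / (1 - x.2 : ℝ) : ℂ) : OnePoint ℂ)

def Sph : Set (ℂ × ℝ) := {x | ‖x.1‖ ^ 2 + x.2 ^ 2 = 1}

lemma sig_mem (z : ℂ) : sig z ∈ Sph := by
  have h : (0 : ℝ) < 1 + ‖z‖ ^ 2 := by positivity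
  simp only [Sph, sig, mem_ofPred_eq, norm_div, norm_mul, Complex.norm_real, Complex.norm_ofNat,
    Real.norm_eq_abs, abs_of_pos h]
  field_simp
  ring

lemma isCompact_Sph : IsCompact Sph := by
  refine Metric.isCompact_of_isClosed_isBounded ?_ ?_
  · exact isClosed_eq (by fun_prop) continuous_const
  · refine (Metric.isBounded_closedBall (x := (0 : ℂ × ℝ)) (r := 1)).subset ?_
    rintro ⟨p, q⟩ h
    simp only [Sph, mem_ofPred_eq] at h
    rw [mem_closedBall_zero_iff, Prod.norm_def, max_le_iff]
    constructor
    · simp only; nlinarith [sq_nonneg q, norm_nonneg p]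
    · simp only [Real.norm_eq_abs]; rw [abs_le]; constructor <;> nlinarith [sq_nonneg ‖p‖]

lemma sigO_tau {x : ℂ × ℝ} (hx : x ∈ Sph) : sigO (tau x) = x := by
  obtain ⟨p, q⟩ := x
  simp only [Sph, mem_ofPred_eq] at hx
  unfold tau
  split_ifs with h
  · simp only at h
    subst h
    have : p = 0 := by
      have : ‖p‖ ^ 2 = 0 := by linarith
      simpa using this
    rw [sigO_inf, this]
  · simp only at h ⊢
    rw [sigO_coe]
    have hq : (1 - q) ≠ 0 := fun h' => h (by linarith)
    have hn : ‖p / ((1 - q : ℝ) : ℂ)‖ ^ 2 = (1 + q) / (1 - q) := by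
      rw [norm_div, div_pow, Complex.norm_real, Real.norm_eq_abs, sq_abs]
      field_simp
      linarith
    have h1 : (1 + (1 + q) / (1 - q)) = 2 / (1 - q) := by field_simp; ring
    have hqc : ((1 - q : ℝ) : ℂ) ≠ 0 := by exact_mod_cast hq
    ext1
    · simp only [sig]
      rw [hn, h1, Complex.ofReal_div]
      field_simp
      push_cast; ring
    · simp only [sig]
      rw [hn, h1]
      field_simp
      ring

lemma tau_sig (z : ℂ) : (sig z).1 / ((1 - (sig z).2 : ℝ) : ℂ) = z := by
  have h : (1 + ‖z‖ ^ 2 : ℝ) ≠ 0 := by positivity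
  have e : (1 - (sig z).2) = 2 / (1 + ‖z‖ ^ 2) := by simp only [sig]; field_simp; ring
  rw [e]
  simp only [sig]
  have hc : ((1 + ‖z‖ ^ 2 : ℝ) : ℂ) ≠ 0 := by exact_mod_cast h
  rw [Complex.ofReal_div]
  field_simp
  push_cast; ring

lemma inv_sig (z : ℂ) : (starRingEnd ℂ) (sig z).1 / ((1 + (sig z).2 : ℝ) : ℂ) = z⁻¹ := by
  by_cases hz : z = 0
  · subst hz; simp [sig]
  have hz' : ‖z‖ ≠ 0 := by simpa using hz
  have h : (1 + ‖z‖ ^ 2 : ℝ) ≠ 0 := by positivity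
  have e : (1 + (sig z).2) = 2 * ‖z‖ ^ 2 / (1 + ‖z‖ ^ 2) := by simp only [sig]; field_simp; ring
  rw [e]
  simp only [sig]
  have hc : ((1 + ‖z‖ ^ 2 : ℝ) : ℂ) ≠ 0 := by exact_mod_cast h
  rw [Complex.ofReal_div, Complex.inv_def, Complex.normSq_eq_norm_sq]
  simp only [map_div₀, map_mul, Complex.conj_ofReal, Complex.conj_ofNat]
  have hz'' : (‖z‖ : ℂ) ≠ 0 := by exact_mod_cast hz'
  push_cast at hc ⊢
  field_simp

lemma sig_dist_sq (z w : ℂ) : ‖(sig z).1 - (sig w).1‖ ^ 2 + ((sig z).2 - (sig w).2) ^ 2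
    = (sdist (z : OnePoint ℂ) (w : OnePoint ℂ)) ^ 2 := by
  have e : sdist (z : OnePoint ℂ) (w : OnePoint ℂ) =
    2 * dist z w / (Real.sqrt (1 + ‖z‖ ^ 2) * Real.sqrt (1 + ‖w‖ ^ 2)) := rfl
  have hz : (1 + ‖z‖ ^ 2 : ℝ) ≠ 0 := by positivity
  have hw : (1 + ‖w‖ ^ 2 : ℝ) ≠ 0 := by positivity
  have hzc : ((1 + ‖z‖ ^ 2 : ℝ) : ℂ) ≠ 0 := by exact_mod_cast hz
  have hwc : ((1 + ‖w‖ ^ 2 : ℝ) : ℂ) ≠ 0 := by exact_mod_cast hw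
  rw [e, div_pow, mul_pow, mul_pow, Real.sq_sqrt (by positivity), Real.sq_sqrt (by positivity),
    dist_eq_norm]
  simp only [sig]
  have h1 : 2 * z / ((1 + ‖z‖ ^ 2 : ℝ) : ℂ) - 2 * w / ((1 + ‖w‖ ^ 2 : ℝ) : ℂ)
    = 2 * (((1 + ‖w‖ ^ 2 : ℝ) : ℂ) * z - ((1 + ‖z‖ ^ 2 : ℝ) : ℂ) * w) /
      (((1 + ‖z‖ ^ 2 : ℝ) : ℂ) * ((1 + ‖w‖ ^ 2 : ℝ) : ℂ)) := by
    field_simp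
  rw [h1, norm_div, norm_mul, norm_mul, Complex.norm_real, Complex.norm_real, Complex.norm_ofNat,
    div_pow, mul_pow, mul_pow]
  simp only [Real.norm_eq_abs, sq_abs]
  have h2 : ‖((1 + ‖w‖ ^ 2 : ℝ) : ℂ) * z - ((1 + ‖z‖ ^ 2 : ℝ) : ℂ) * w‖ ^ 2 =
      (1 + ‖w‖ ^ 2) * (1 + ‖z‖ ^ 2) * ‖z - w‖ ^ 2 - (‖z‖ ^ 2 - ‖w‖ ^ 2) ^ 2 := by
    simp only [← Complex.normSq_eq_norm_sq, Complex.normSq_apply]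
    simp
    ring
  rw [h2]
  field_simp
  ring

lemma sig_dist_sq_inf (z : ℂ) : ‖(sig z).1 - 0‖ ^ 2 + ((sig z).2 - 1) ^ 2
    = (sdist (z : OnePoint ℂ) ∞) ^ 2 := by
  have e : sdist (z : OnePoint ℂ) ∞ =
    2 / (Real.sqrt (1 + ‖z‖ ^ 2)) := rfl
  have hz : (0 : ℝ) < (1 + ‖z‖ ^ 2 : ℝ) := by positivity
  rw [e, div_pow, Real.sq_sqrt (by positivity)]
  simp only [sig, sub_zero, norm_div, norm_mul, Complex.norm_real, Complex.norm_ofNat,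
    Real.norm_eq_abs, abs_of_pos hz]
  field_simp
  ring

lemma sdist_nonneg (u v : OnePoint ℂ) : 0 ≤ sdist u v := by
  unfold sdist
  split <;> positivity

lemma sdist_le (z : ℂ) (u : OnePoint ℂ) :
    sdist (z : OnePoint ℂ) u ≤ 2 * dist (sig z) (sigO u) := by
  have key : ‖(sig z).1 - (sigO u).1‖ ^ 2 + ((sig z).2 - (sigO u).2) ^ 2
    = (sdist (z : OnePoint ℂ) u) ^ 2 := by
    induction u using OnePoint.rec with
    | infty => exact sig_dist_sq_inf z
    | coe w => exact sig_dist_sq z w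
  rw [Prod.dist_eq, dist_eq_norm, dist_eq_norm, Real.norm_eq_abs]
  have h0 := sdist_nonneg (z : OnePoint ℂ) u
  rw [← sq_abs ((sig z).2 - (sigO u).2)] at key
  have h1 := le_max_left ‖(sig z).1 - (sigO u).1‖ |(sig z).2 - (sigO u).2|
  have h2 := le_max_right ‖(sig z).1 - (sigO u).1‖ |(sig z).2 - (sigO u).2|
  have h3 := norm_nonneg ((sig z).1 - (sigO u).1)
  have h4 := abs_nonneg ((sig z).2 - (sigO u).2)
  refine abs_le_of_sq_le_sq' (b := 2 * max ‖(sig z).1 - (sigO u).1‖ |(sig z).2 - (sigO u).2|) ?_ ?_ |>.2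
  all_goals nlinarith

lemma dist_sig_le (z w : ℂ) :
    dist (sig z) (sig w) ≤ 2 * dist z w / (Real.sqrt (1 + ‖z‖ ^ 2) * Real.sqrt (1 + ‖w‖ ^ 2)) := by
  have key := sig_dist_sq z w
  change _ ≤ sdist (z : OnePoint ℂ) (w : OnePoint ℂ)
  have h0 := sdist_nonneg (z : OnePoint ℂ) w
  rw [Prod.dist_eq, dist_eq_norm, dist_eq_norm, Real.norm_eq_abs]
  refine max_le ?_ ?_
  · exact abs_le_of_sq_le_sq' (by nlinarith [sq_nonneg ((sig z).2 - (sig w).2)]) h0 |>.2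
  · exact abs_le_of_sq_le_sq (by nlinarith [sq_nonneg ‖(sig z).1 - (sig w).1‖]) h0

lemma continuous_sig : Continuous sig := by
  unfold sig
  refine Continuous.prodMk ?_ ?_
  · refine Continuous.div (by fun_prop) (by fun_prop) ?_
    intro z
    have : (1 + ‖z‖ ^ 2 : ℝ) ≠ 0 := by positivity
    exact_mod_cast this
  · exact Continuous.div (by fun_prop) (by fun_prop) (fun z => by positivity)

lemma zal_aa {E : Type*} [MetricSpace E] [CompleteSpace E] (S : Set E) (hS : IsCompact S)
    (G : ℕ → ℂ → E) (hG : ∀ n z, G n z ∈ S) (U : Set ℂ)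
    (heq : ∀ z ∈ U, ∀ ε > (0 : ℝ), ∃ δ > 0, ∀ᶠ n in atTop, ∀ w ∈ Metric.ball z δ,
      dist (G n w) (G n z) ≤ ε) :
    ∃ φ : ℕ → ℕ, StrictMono φ ∧ ∃ H : ℂ → E, (∀ z ∈ U, H z ∈ S) ∧
      ∀ z ∈ U, Tendsto (fun p : ℕ × ℂ => G (φ p.1) p.2) (atTop ×ˢ 𝓝 z) (𝓝 (H z)) := by
  have hc : IsCompact (Set.pi univ (fun _ : ℕ => S)) := isCompact_univ_pi (fun _ => hS)
  obtain ⟨b, -, φ, hφ, hb⟩ := hc.tendsto_subseq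
    (x := fun n => fun k => G n (TopologicalSpace.denseSeq ℂ k)) (fun n k _ => hG n _)
  rw [tendsto_pi_nhds] at hb
  have hlim : ∀ z ∈ U, ∃ L ∈ S, Tendsto (fun n => G (φ n) z) atTop (𝓝 L) := by
    intro z hz
    have hcs : CauchySeq (fun n => G (φ n) z) := by
      rw [Metric.cauchySeq_iff']
      intro ε hε
      obtain ⟨δ, hδ, h⟩ := heq z hz (ε / 4) (by positivity)
      obtain ⟨_, hk, ⟨k, rfl⟩⟩ := (TopologicalSpace.denseRange_denseSeq ℂ).exists_mem_open
        Metric.isOpen_ball ⟨z, Metric.mem_ball_self hδ⟩ |>.imp fun k hk => 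
          (⟨hk, k, rfl⟩ : TopologicalSpace.denseSeq ℂ k ∈ Metric.ball z δ ∧ ∃ k', k' = k)
      have h1 := hφ.tendsto_atTop.eventually h
      have h2 := (Metric.tendsto_nhds.1 (hb k)) (ε / 8) (by positivity)
      obtain ⟨N, hN⟩ := eventually_atTop.1 (h1.and h2)
      refine ⟨N, fun n hn => ?_⟩
      have a1 := (hN n hn).1 _ hk
      have a2 := (hN N le_rfl).1 _ hk
      have b1 := (hN n hn).2
      have b2 := (hN N le_rfl).2
      simp only [Function.comp] at b1 b2
      set q := TopologicalSpace.denseSeq ℂ k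
      have t1 := dist_triangle4 (G (φ n) z) (G (φ n) q) (G (φ N) q) (G (φ N) z)
      have t2 := dist_triangle_right (G (φ n) q) (G (φ N) q) (b k)
      rw [dist_comm (G (φ n) z) (G (φ n) q)] at t1
      linarith
    obtain ⟨L, hL⟩ := cauchySeq_tendsto_of_complete hcs
    exact ⟨L, hS.isClosed.mem_of_tendsto hL (Eventually.of_forall fun n => hG _ _), hL⟩
  have : Nonempty E := ⟨G 0 0⟩
  choose! H hHS hH using hlim
  refine ⟨φ, hφ, H, hHS, fun z hz => ?_⟩
  rw [Metric.tendsto_nhds]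
  intro ε hε
  obtain ⟨δ, hδ, h⟩ := heq z hz (ε / 2) (by positivity)
  have h1 := hφ.tendsto_atTop.eventually h
  have h2 := (Metric.tendsto_nhds.1 (hH z hz)) (ε / 2) (by positivity)
  have := (h1.and h2).prod_mk (Metric.ball_mem_nhds z hδ : ∀ᶠ w in 𝓝 z, w ∈ Metric.ball z δ)
  filter_upwards [this] with p hp
  have a1 := hp.1.1 _ hp.2
  have a2 := hp.1.2
  have := dist_triangle (G (φ p.1) p.2) (G (φ p.1) z) (H z)
  linarith

lemma zal_cc {E : Type*} [MetricSpace E] (c : ℕ → ℂ → E) (H : ℂ → E) (U : Set ℂ) (hU : IsOpen U)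
    (h : ∀ z ∈ U, Tendsto (fun p : ℕ × ℂ => c p.1 p.2) (atTop ×ˢ 𝓝 z) (𝓝 (H z))) :
    TendstoLocallyUniformlyOn c H atTop U ∧ ContinuousOn H U := by
  have key : ∀ z ∈ U, ∀ ε > 0, ∃ N, ∃ V ∈ 𝓝 z, V ⊆ U ∧ 
      (∀ n ≥ N, ∀ w ∈ V, dist (c n w) (H z) < ε) ∧ ∀ w ∈ V, dist (H w) (H z) ≤ ε := by
    intro z hz ε hε
    have h1 := Metric.tendsto_nhds.1 (h z hz) ε hε
    obtain ⟨P, hP, Q, hQ, hPQ⟩ := eventually_prod_iff.1 h1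
    obtain ⟨N, hN⟩ := eventually_atTop.1 hP
    refine ⟨N, {w | Q w} ∩ U, inter_mem hQ (hU.mem_nhds hz), inter_subset_right, 
      fun n hn w hw => hPQ (hN n hn) hw.1, fun w hw => ?_⟩
    have : Tendsto (fun n => c n w) atTop (𝓝 (H w)) := 
      (h w hw.2).comp (tendsto_id.prodMk (tendsto_const_nhds (x := w)))
    refine le_of_tendsto (this.dist tendsto_const_nhds) ?_
    filter_upwards [eventually_ge_atTop N] with n hn
    exact (hPQ (hN n hn) hw.1).le
  constructor
  · rw [Metric.tendstoLocallyUniformlyOn_iff]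
    intro ε hε z hz
    obtain ⟨N, V, hV, hVU, h1, h2⟩ := key z hz (ε / 2) (by positivity)
    refine ⟨V, mem_nhdsWithin_of_mem_nhds hV, ?_⟩
    filter_upwards [eventually_ge_atTop N] with n hn w hw
    have a1 := h1 n hn w hw
    have a2 := h2 w hw
    have := dist_triangle_right (H w) (c n w) (H z)
    linarith
  · intro z hz
    refine ContinuousAt.continuousWithinAt ?_
    rw [ContinuousAt, Metric.tendsto_nhds]
    intro ε hε
    obtain ⟨N, V, hV, hVU, h1, h2⟩ := key z hz (ε / 2) (by positivity)
    filter_upwards [hV] with w hw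
    linarith [h2 w hw]

noncomputable def sd (f : ℂ → ℂ) (z : ℂ) : ℝ := 2 * ‖deriv f z‖ / (1 + ‖f z‖ ^ 2)

lemma sd_nonneg (f : ℂ → ℂ) (z : ℂ) : 0 ≤ sd f z := by unfold sd; positivity

lemma zal_lip (f : ℂ → ℂ) (z₀ : ℂ) (R C : ℝ) (hf : ∀ z ∈ Metric.ball z₀ R, DifferentiableAt ℂ f z)
    (hC : ∀ z ∈ Metric.ball z₀ R, sd f z ≤ C) (w : ℂ) (hw : w ∈ Metric.ball z₀ R) :
    dist (sig (f w)) (sig (f z₀)) ≤ C * dist w z₀ := by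
  set γ : ℝ → ℂ := fun t => z₀ + t * (w - z₀) with hγ
  have hγm : ∀ t ∈ Icc (0 : ℝ) 1, γ t ∈ Metric.ball z₀ R := by
    intro t ht
    rw [Metric.mem_ball, dist_eq_norm] at *
    simp only [hγ, add_sub_cancel_left, norm_mul, Complex.norm_real, Real.norm_eq_abs, 
      abs_of_nonneg ht.1]
    nlinarith [ht.2, norm_nonneg (w - z₀)]
  have hγc : Continuous γ := by fun_prop
  set u : ℝ → ℝ := fun t => dist (sig (f (γ t))) (sig (f z₀)) with hu
  have hfc : ∀ t ∈ Icc (0 : ℝ) 1, ContinuousAt (fun s => f (γ s)) t := fun t ht =>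
    ContinuousAt.comp (f := γ) (hf _ (hγm t ht)).continuousAt hγc.continuousAt
  have huc : ContinuousOn u (Icc 0 1) := by
    intro t ht
    refine ContinuousAt.continuousWithinAt ?_
    exact ((continuous_sig.continuousAt).comp (hfc t ht)).dist continuousAt_const
  have main := image_le_of_liminf_slope_right_le_deriv_boundary (f := u) (a := 0) (b := 1) huc
    (B := fun t => C * dist w z₀ * t) (B' := fun _ => C * dist w z₀) (by simp [hu, hγ])
    (by fun_prop) (fun t _ => by simpa using ((hasDerivAt_id t).const_mul (C * dist w z₀)).hasDerivWithinAt)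
    ?_
  · have := main (x := 1) (by simp)
    simpa [hu, hγ] using this
  intro t ht r hr
  have ht' : t ∈ Icc (0 : ℝ) 1 := ⟨ht.1, ht.2.le⟩
  refine Eventually.frequently ?_
  set c := f (γ t) with hc
  -- the quotient bound
  have hder : HasDerivAt (fun s => f (γ s)) (deriv f (γ t) * (w - z₀)) t := by
    have h1 : HasDerivAt γ (w - z₀) t := by
      have := ((Complex.ofRealCLM.hasDerivAt (x := t)).mul_const (w - z₀)).const_add z₀
      have e : γ = fun t : ℝ => z₀ + Complex.ofRealCLM t * (w - z₀) := by ext t; simp [hγ]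
      rw [e]
      simpa only [Complex.ofRealCLM_apply, Complex.ofReal_one, one_mul] using! this
    have := HasDerivAt.comp (h := γ) t (hf _ (hγm t ht')).hasDerivAt h1
    simpa [Function.comp_def] using this
  have hs : Tendsto (fun s => ‖slope (fun s => f (γ s)) t s‖) (𝓝[>] t) 
      (𝓝 ‖deriv f (γ t) * (w - z₀)‖) := 
    ((hasDerivAt_iff_tendsto_slope.1 hder).mono_left (nhdsWithin_mono _ (fun s hs => ne_of_gt hs))).norm
  have hden : Tendsto (fun s => Real.sqrt (1 + ‖f (γ s)‖ ^ 2) * Real.sqrt (1 + ‖c‖ ^ 2)) (𝓝[>] t)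
      (𝓝 (Real.sqrt (1 + ‖c‖ ^ 2) * Real.sqrt (1 + ‖c‖ ^ 2))) := by
    have h1 : Tendsto (fun s => f (γ s)) (𝓝[>] t) (𝓝 c) := 
      (hfc t ht').tendsto.mono_left nhdsWithin_le_nhds
    exact (((h1.norm.pow 2).const_add 1).sqrt).mul_const _
  have hq := (hs.const_mul 2).div hden (by positivity)
  rw [Real.mul_self_sqrt (by positivity)] at hq
  have hlt : 2 * ‖deriv f (γ t) * (w - z₀)‖ / (1 + ‖c‖ ^ 2) < r := by
    refine lt_of_le_of_lt ?_ hr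
    have := mul_le_mul_of_nonneg_right (hC _ (hγm t ht')) (dist_nonneg (x := w) (y := z₀))
    refine le_trans (le_of_eq ?_) this
    rw [sd, norm_mul, dist_eq_norm]
    ring
  filter_upwards [hq.eventually_lt_const hlt, self_mem_nhdsWithin] with s hs1 hs2
  refine lt_of_le_of_lt ?_ hs1
  have hst : 0 < s - t := sub_pos.2 hs2
  rw [slope_def_field, div_le_iff₀ hst]
  have h1 : u s - u t ≤ dist (sig (f (γ s))) (sig (f (γ t))) := by
    have := dist_triangle (sig (f (γ s))) (sig (f (γ t))) (sig (f z₀))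
    simp only [hu]; linarith
  refine h1.trans ((dist_sig_le _ _).trans (le_of_eq ?_))
  have h2 : ‖slope (fun s => f (γ s)) t s‖ = (s - t)⁻¹ * dist (f (γ s)) (f (γ t)) := by
    rw [slope, norm_smul, norm_inv, Real.norm_eq_abs, abs_of_pos hst, vsub_eq_sub, dist_eq_norm]
  simp only [Pi.div_apply, h2]
  field_simp
  rfl

lemma sd_continuousOn (f : ℂ → ℂ) (Ω : Set ℂ) (hΩ : IsOpen Ω) (hf : DifferentiableOn ℂ f Ω) :
    ContinuousOn (sd f) Ω := by
  unfold sd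
  refine ContinuousOn.div ?_ ?_ (fun z _ => by positivity)
  · exact continuousOn_const.mul ((hf.deriv hΩ).continuousOn.norm)
  · exact continuousOn_const.add (hf.continuousOn.norm.pow 2)

lemma zal_unif (c : ℕ → ℂ → ℂ) (H : ℂ → ℂ × ℝ) (U : Set ℂ) (hU : IsOpen U)
    (hS : ∀ z ∈ U, H z ∈ Sph)
    (h : ∀ z ∈ U, Tendsto (fun p : ℕ × ℂ => sig (c p.1 p.2)) (atTop ×ˢ 𝓝 z) (𝓝 (H z)))
    (K : Set ℂ) (hKU : K ⊆ U) (hK : IsCompact K) (ε : ℝ) (hε : 0 < ε) :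
    ∃ M, ∀ j ≥ M, ∀ z ∈ K, sdist ((c j z : ℂ) : OnePoint ℂ) (tau (H z)) < ε := by
  have h1 := (zal_cc (fun n z => sig (c n z)) H U hU h).1
  have h2 := (tendstoLocallyUniformlyOn_iff_forall_isCompact hU).1 h1 K hKU hK
  rw [Metric.tendstoUniformlyOn_iff] at h2
  obtain ⟨M, hM⟩ := eventually_atTop.1 (h2 (ε / 2) (by positivity))
  refine ⟨M, fun j hj z hz => ?_⟩
  have h3 := hM j hj z hz
  have h4 := sdist_le (c j z) (tau (H z))
  rw [sigO_tau (hS z (hKU hz)), dist_comm] at h4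
  linarith

lemma zal_marty (F : Set (ℂ → ℂ)) (a : ℂ) (r C : ℝ)
    (hF : ∀ f ∈ F, DifferentiableOn ℂ f (Metric.ball a r))
    (hC : ∀ f ∈ F, ∀ z ∈ Metric.ball a r, sd f z ≤ C)
    (f : ℕ → ℂ → ℂ) (hf : ∀ k, f k ∈ F) :
    ∃ φ : ℕ → ℕ, StrictMono φ ∧ ∃ h : ℂ → OnePoint ℂ,
      ∀ K : Set ℂ, K ⊆ Metric.ball a r → IsCompact K → ∀ ε > (0 : ℝ), ∃ M, ∀ j ≥ M, ∀ z ∈ K,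
        sdist ((f (φ j) z : ℂ) : OnePoint ℂ) (h z) < ε := by
  obtain ⟨φ, hφ, H, hHS, hH⟩ := zal_aa Sph isCompact_Sph (fun n z => sig (f n z))
    (fun n z => sig_mem _) (Metric.ball a r) (by
      intro z hz ε hε
      obtain ⟨R, hR, hRs⟩ := Metric.isOpen_iff.1 Metric.isOpen_ball z hz
      refine ⟨min R (ε / (|C| + 1)), by positivity, Eventually.of_forall fun n w hw => ?_⟩
      rw [Metric.mem_ball, lt_min_iff] at hw
      have h1 := zal_lip (f n) z R C
        (fun y hy => (hF _ (hf n)).differentiableAt (Metric.isOpen_ball.mem_nhds (hRs hy)))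
        (fun y hy => hC _ (hf n) y (hRs hy)) w hw.1
      refine h1.trans ?_
      have h2 := hw.2
      rw [lt_div_iff₀ (by positivity)] at h2
      nlinarith [le_abs_self C, dist_nonneg (x := w) (y := z)])
  exact ⟨φ, hφ, fun z => tau (H z), fun K hK hKc ε hε =>
    zal_unif (fun n => f (φ n)) H _ Metric.isOpen_ball hHS hH K hK hKc ε hε⟩

lemma zal_select (Ω : Set ℂ) (hΩ : IsOpen Ω) (a : ℂ) 
    (f : ℂ → ℂ) (hf : DifferentiableOn ℂ f Ω) (r : ℝ) (hr : 0 < r) (hrΩ : Metric.closedBall a r ⊆ Ω)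
    (m : ℝ) (hm : 1 ≤ m) (y : ℂ) (hy : y ∈ Metric.ball a (r / 2)) (hyd : 2 * m / r < sd f y) :
    ∃ (x : ℂ) (ρ : ℝ), x ∈ Ω ∧ dist x a ≤ r ∧ 0 < ρ ∧ ρ ≤ r ∧ ρ * sd f x = 1 ∧
      ∀ v : ℂ, ‖v‖ ≤ m / 2 → x + ρ * v ∈ Ω ∧ ρ * sd f (x + ρ * v) ≤ 2 := by
  obtain ⟨x, hx, hmax⟩ := (isCompact_closedBall a r).exists_isMaxOn 
    (f := fun z => (r - dist z a) * sd f z) ⟨a, by simp [hr.le]⟩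
    (ContinuousOn.mul (by fun_prop) ((sd_continuousOn f Ω hΩ hf).mono hrΩ))
  rw [isMaxOn_iff] at hmax
  rw [Metric.mem_closedBall] at hx
  rw [Metric.mem_ball] at hy
  have hM : m < (r - dist x a) * sd f x := by
    have h1 := hmax y (by rw [Metric.mem_closedBall]; linarith)
    rw [div_lt_iff₀ hr] at hyd
    have h2 := sd_nonneg f y
    nlinarith
  have hsd : 0 < sd f x := by
    rcases (sd_nonneg f x).eq_or_lt with h | h
    · rw [← h] at hM; linarith
    · exact h
  have hd : 0 < r - dist x a := by
    by_contra hcon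
    have : (r - dist x a) * sd f x ≤ 0 := mul_nonpos_of_nonpos_of_nonneg (by linarith) hsd.le
    linarith
  have hMinv : m * (sd f x)⁻¹ < r - dist x a := by
    rw [← div_eq_mul_inv, div_lt_iff₀ hsd]; exact hM
  have hip : 0 < (sd f x)⁻¹ := by positivity
  refine ⟨x, (sd f x)⁻¹, hrΩ hx, hx, hip, ?_, inv_mul_cancel₀ hsd.ne', ?_⟩
  · nlinarith [dist_nonneg (x := x) (y := a)]
  intro v hv
  set z := x + ((sd f x)⁻¹ : ℝ) * v with hz
  have hzd : dist z x ≤ (r - dist x a) / 2 := by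
    rw [hz, dist_eq_norm, add_sub_cancel_left, norm_mul, Complex.norm_real, Real.norm_eq_abs,
      abs_of_pos hip]
    nlinarith
  have hza := dist_triangle z x a
  have hzc : z ∈ Metric.closedBall a r := by rw [Metric.mem_closedBall]; linarith
  refine ⟨hrΩ hzc, ?_⟩
  have h1 := hmax z hzc
  have h2 : (r - dist x a) / 2 * sd f z ≤ (r - dist x a) * sd f x := by
    refine le_trans (mul_le_mul_of_nonneg_right ?_ (sd_nonneg f z)) h1
    linarith
  have h3 : sd f z ≤ 2 * sd f x := by
    by_contra hcon
    push Not at hcon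
    nlinarith
  rw [inv_mul_le_iff₀ hsd]
  linarith

lemma zal_seq (Ω : Set ℂ) (hΩ : IsOpen Ω) (a : ℂ) (ha : a ∈ Ω)
    (F : Set (ℂ → ℂ)) (hF : ∀ f ∈ F, DifferentiableOn ℂ f Ω)
    (hnotnormal : ¬ ∃ U : Set ℂ, IsOpen U ∧ a ∈ U ∧ U ⊆ Ω ∧
      ∀ f : ℕ → ℂ → ℂ, (∀ k, f k ∈ F) →
        ∃ φ : ℕ → ℕ, StrictMono φ ∧ ∃ h : ℂ → OnePoint ℂ,
          ∀ K : Set ℂ, K ⊆ U → IsCompact K → ∀ ε > (0 : ℝ), ∃ M, ∀ j ≥ M, ∀ z ∈ K,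
            sdist ((f (φ j) z : ℂ) : OnePoint ℂ) (h z) < ε) :
    ∃ r₀ > (0 : ℝ), ∀ n : ℕ, ∃ f ∈ F, ∃ (x : ℂ) (ρ : ℝ), x ∈ Ω ∧ dist x a ≤ r₀ / (n + 1) ∧
      0 < ρ ∧ ρ ≤ r₀ / (n + 1) ∧ ρ * sd f x = 1 ∧
      ∀ v : ℂ, ‖v‖ ≤ ((n : ℝ) + 1) / 2 → x + ρ * v ∈ Ω ∧ ρ * sd f (x + ρ * v) ≤ 2 := by
  obtain ⟨r₀, hr₀, hsub⟩ := Metric.nhds_basis_closedBall.mem_iff.1 (hΩ.mem_nhds ha)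
  refine ⟨r₀, hr₀, fun n => ?_⟩
  set r := r₀ / (n + 1) with hr
  have hrpos : 0 < r := by positivity
  have hle : r ≤ r₀ := div_le_self hr₀.le (by linarith [n.cast_nonneg (α := ℝ)])
  have hrΩ : Metric.closedBall a r ⊆ Ω := (Metric.closedBall_subset_closedBall hle).trans hsub
  have hbΩ : Metric.ball a (r / 2) ⊆ Ω := 
    ((Metric.ball_subset_ball (by linarith)).trans Metric.ball_subset_closedBall).trans hrΩ
  have : ∃ f ∈ F, ∃ y ∈ Metric.ball a (r / 2), 2 * ((n : ℝ) + 1) / r < sd f y := by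
    by_contra hcon
    push Not at hcon
    exact hnotnormal ⟨Metric.ball a (r / 2), Metric.isOpen_ball, 
      Metric.mem_ball_self (by positivity), hbΩ, fun f hf => 
        zal_marty F a (r / 2) _ (fun f hf => (hF f hf).mono hbΩ) hcon f hf⟩
  obtain ⟨f, hf, y, hy, hyd⟩ := this
  exact ⟨f, hf, zal_select Ω hΩ a f (hF f hf) r hrpos hrΩ _ (by linarith [n.cast_nonneg (α := ℝ)])
    y hy hyd⟩

lemma zal_lim (c : ℕ → ℂ → ℂ) (g : ℂ → ℂ) (U : Set ℂ) (hU : IsOpen U)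
    (h : ∀ z ∈ U, Tendsto (fun p : ℕ × ℂ => c p.1 p.2) (atTop ×ˢ 𝓝 z) (𝓝 (g z)))
    (hd : ∀ z ∈ U, ∀ᶠ p : ℕ × ℂ in atTop ×ˢ 𝓝 z, DifferentiableAt ℂ (c p.1) p.2) (z : ℂ)
    (hz : z ∈ U) : AnalyticAt ℂ g z ∧
      Tendsto (fun n => deriv (c n) z) atTop (𝓝 (deriv g z)) := by
  obtain ⟨P, hP, Q, hQ, hPQ⟩ := eventually_prod_iff.1 (hd z hz)
  obtain ⟨V, hVs, hV, hzV⟩ := mem_nhds_iff.1 (inter_mem hQ (hU.mem_nhds hz))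
  have h1 := (zal_cc c g V hV (fun w hw => h w (hVs hw).2)).1
  have h2 : ∀ᶠ n in atTop, DifferentiableOn ℂ (c n) V := by
    filter_upwards [hP] with n hn w hw
    exact (hPQ hn (hVs hw).1).differentiableWithinAt
  refine ⟨(h1.differentiableOn h2 hV).analyticAt (hV.mem_nhds hzV), ?_⟩
  exact (h1.deriv h2 hV).tendsto_at hzV

lemma sd_inv (f : ℂ → ℂ) (z : ℂ) (hf : DifferentiableAt ℂ f z) (h0 : f z ≠ 0) :
    sd (fun w => (f w)⁻¹) z = sd f z := by
  unfold sd
  rw [(hf.hasDerivAt.fun_inv h0).deriv]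
  have : ‖f z‖ ≠ 0 := by simpa using h0
  simp only [norm_div, norm_neg, norm_pow, norm_inv]
  field_simp
  ring

lemma zal_main (c : ℕ → ℂ → ℂ) (H : ℂ → ℂ × ℝ) (hS : ∀ z, H z ∈ Sph)
    (h : ∀ z, Tendsto (fun p : ℕ × ℂ => sig (c p.1 p.2)) (atTop ×ˢ 𝓝 z) (𝓝 (H z)))
    (hd : ∀ z, ∀ᶠ p : ℕ × ℂ in atTop ×ˢ 𝓝 z, DifferentiableAt ℂ (c p.1) p.2)
    (hsd : ∀ n, sd (c n) 0 = 1) :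
    MeromorphicToSphere (fun z => tau (H z)) univ ∧ ∃ v w : ℂ, tau (H v) ≠ tau (H w) := by
  have hHc : Continuous H := continuousOn_univ.1
    (zal_cc (fun n z => sig (c n z)) H univ isOpen_univ (fun z _ => h z)).2
  set P : ℂ → ℂ := fun z => (H z).1 / ((1 - (H z).2 : ℝ) : ℂ) with hP
  set Q : ℂ → ℂ := fun z => (starRingEnd ℂ) (H z).1 / ((1 + (H z).2 : ℝ) : ℂ) with hQ
  set U1 : Set ℂ := {z | (H z).2 ≠ 1} with hU1
  set U2 : Set ℂ := {z | (H z).2 ≠ -1} with hU2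
  have hU1o : IsOpen U1 := isOpen_ne_fun (by fun_prop) continuous_const
  have hU2o : IsOpen U2 := isOpen_ne_fun (by fun_prop) continuous_const
  have A1 : ∀ z ∈ U1, AnalyticAt ℂ P z ∧
      Tendsto (fun n => deriv (c n) z) atTop (𝓝 (deriv P z)) := by
    refine zal_lim c P U1 hU1o (fun z hz => ?_) (fun z _ => hd z)
    have hne : ((1 - (H z).2 : ℝ) : ℂ) ≠ 0 := by
      have : 1 - (H z).2 ≠ 0 := fun h' => hz (by linarith)
      exact_mod_cast this
    have hcont : ContinuousAt (fun x : ℂ × ℝ => x.1 / ((1 - x.2 : ℝ) : ℂ)) (H z) :=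
      ContinuousAt.div (by fun_prop) (by fun_prop) hne
    have := hcont.tendsto.comp (h z)
    simpa only [Function.comp_def, tau_sig] using this
  have hne0 : ∀ z ∈ U2, ∀ᶠ p : ℕ × ℂ in atTop ×ˢ 𝓝 z, c p.1 p.2 ≠ 0 := by
    intro z hz
    have h1 := (continuous_snd.tendsto (H z)).comp (h z)
    filter_upwards [h1.eventually_ne hz] with p hp h0
    apply hp
    simp [h0, sig]
  have A2 : ∀ z ∈ U2, AnalyticAt ℂ Q z ∧
      Tendsto (fun n => deriv (fun w => (c n w)⁻¹) z) atTop (𝓝 (deriv Q z)) := by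
    refine zal_lim (fun n w => (c n w)⁻¹) Q U2 hU2o (fun z hz => ?_) (fun z hz => ?_)
    · have hne : ((1 + (H z).2 : ℝ) : ℂ) ≠ 0 := by
        have : 1 + (H z).2 ≠ 0 := fun h' => hz (by linarith)
        exact_mod_cast this
      have hcont : ContinuousAt (fun x : ℂ × ℝ => (starRingEnd ℂ) x.1 / ((1 + x.2 : ℝ) : ℂ)) (H z) :=
        ContinuousAt.div (Complex.continuous_conj.comp continuous_fst).continuousAt (by fun_prop) hne
      have := hcont.tendsto.comp (h z)
      simpa only [Function.comp_def, inv_sig] using this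
    · filter_upwards [hd z, hne0 z hz] with p hp1 hp2
      exact hp1.fun_inv hp2
  have htau1 : ∀ z ∈ U1, tau (H z) = ((P z : ℂ) : OnePoint ℂ) := by
    intro z hz
    exact if_neg hz
  have htau2 : ∀ z, z ∉ U1 → tau (H z) = ∞ := by
    intro z hz
    exact if_pos (not_not.1 hz)
  have hQ0 : ∀ z, z ∉ U1 → Q z = 0 := by
    intro z hz
    have h1 : (H z).2 = 1 := not_not.1 hz
    have h2 : ‖(H z).1‖ ^ 2 + (H z).2 ^ 2 = 1 := hS z
    rw [h1] at h2
    have h3 : (H z).1 = 0 := by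
      have : ‖(H z).1‖ ^ 2 = 0 := by linarith
      simpa using this
    simp [hQ, h3]
  have hPQ : ∀ z ∈ U2, z ∈ U1 → P z = (Q z)⁻¹ ∧ Q z ≠ 0 := by
    intro z hz2 hz1
    have h2 : ‖(H z).1‖ ^ 2 + (H z).2 ^ 2 = 1 := hS z
    have n1 : 1 - (H z).2 ≠ 0 := fun h' => hz1 (by linarith)
    have n2 : 1 + (H z).2 ≠ 0 := fun h' => hz2 (by linarith)
    have n1c : ((1 - (H z).2 : ℝ) : ℂ) ≠ 0 := by exact_mod_cast n1
    have n2c : ((1 + (H z).2 : ℝ) : ℂ) ≠ 0 := by exact_mod_cast n2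
    have h3 : (H z).1 * (starRingEnd ℂ) (H z).1 =
        ((1 - (H z).2 : ℝ) : ℂ) * ((1 + (H z).2 : ℝ) : ℂ) := by
      rw [Complex.mul_conj, Complex.normSq_eq_norm_sq, ← Complex.ofReal_mul]
      congr 1
      linarith
    have h4 : P z * Q z = 1 := by
      simp only [hP, hQ]
      rw [div_mul_div_comm, h3, div_self (mul_ne_zero n1c n2c)]
    exact ⟨eq_inv_of_mul_eq_one_left h4, right_ne_zero_of_mul_eq_one h4⟩
  have h12 : ∀ z, z ∉ U1 → z ∈ U2 := by
    intro z hz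
    have h1 : (H z).2 = 1 := not_not.1 hz
    change (H z).2 ≠ -1
    rw [h1]; norm_num
  have hsmall : ∀ e : ℕ → ℂ → ℂ, (∀ᶠ n in atTop, sd (e n) 0 = 1) →
      ¬ Tendsto (fun n => deriv (e n) 0) atTop (𝓝 0) := by
    intro e he ht
    have h1 := (ht.norm).eventually_lt_const (u := 1 / 2) (by simp)
    obtain ⟨n, hn1, hn2⟩ := (he.and h1).exists
    rw [sd, div_eq_one_iff_eq (by positivity)] at hn1
    nlinarith [sq_nonneg ‖e n 0‖]
  have hnc : ∃ v w : ℂ, tau (H v) ≠ tau (H w) := by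
    by_contra hcon
    push Not at hcon
    have hH0 : ∀ z, H z = H 0 := fun z => by
      rw [← sigO_tau (hS z), hcon z 0, sigO_tau (hS 0)]
    by_cases h0 : (0 : ℂ) ∈ U1
    · have hPc : P = fun _ => P 0 := by ext z; simp only [hP, hH0 z]
      have := (A1 0 h0).2
      rw [hPc, deriv_const] at this
      exact hsmall c (Eventually.of_forall hsd) this
    · have hQc : Q = fun _ => Q 0 := by ext z; simp only [hQ, hH0 z]
      have := (A2 0 (h12 0 h0)).2
      rw [hQc, deriv_const] at this
      refine hsmall _ ?_ this
      have hpt : Tendsto (fun n : ℕ => (n, (0 : ℂ))) atTop (atTop ×ˢ 𝓝 0) :=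
        tendsto_id.prodMk tendsto_const_nhds
      filter_upwards [hpt.eventually (hd 0), hpt.eventually (hne0 0 (h12 0 h0))] with n hn1 hn2
      rw [sd_inv _ _ hn1 hn2, hsd]
  refine ⟨?_, hnc⟩
  have hisol : ∀ z, z ∉ U1 → ∀ᶠ w in 𝓝[≠] z, Q w ≠ 0 := by
    have hloc : ∀ z, z ∉ U1 → (∀ᶠ w in 𝓝 z, Q w = 0) → ∀ᶠ w in 𝓝 z, w ∉ U1 := by
      intro z hz hq
      filter_upwards [hq, hU2o.mem_nhds (h12 z hz)] with w hw1 hw2 hw3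
      exact (hPQ w hw2 hw3).2 hw1
    intro z hz
    refine (A2 z (h12 z hz)).1.eventually_eq_zero_or_eventually_ne_zero.resolve_left fun hq => ?_
    set A : Set ℂ := {z | ∀ᶠ w in 𝓝 z, w ∉ U1} with hA
    have hAo : IsOpen A := isOpen_setOfPred_eventually_nhds
    have hAc : IsClosed A := by
      refine isClosed_of_closure_subset fun y hy => ?_
      by_contra hyA
      have hyU : y ∉ U1 := by
        have : closure A ⊆ U1ᶜ := closure_minimal (fun w hw => (Eventually.self_of_nhds hw :))
          hU1o.isClosed_compl
        exact this hy
      have hfr : ∃ᶠ w in 𝓝[≠] y, Q w = 0 := by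
        rw [mem_closure_iff_frequently] at hy
        rw [frequently_nhdsWithin_iff]
        refine hy.mono fun w hw => ⟨hQ0 w (Eventually.self_of_nhds hw :), ?_⟩
        rintro rfl
        exact hyA hw
      exact hyA (hloc y hyU ((A2 y (h12 y hyU)).1.frequently_zero_iff_eventually_zero.1 hfr))
    have hAu : A = univ := IsClopen.eq_univ ⟨hAc, hAo⟩ ⟨z, hloc z hz hq⟩
    obtain ⟨v, w, hvw⟩ := hnc
    have hall : ∀ y, y ∉ U1 := fun y => by
      have : ∀ᶠ w in 𝓝 y, w ∉ U1 := (hAu ▸ mem_univ y : y ∈ A)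
      exact this.self_of_nhds (p := fun w => w ∉ U1)
    exact hvw (by rw [htau2 v (hall v), htau2 w (hall w)])
  intro z _
  by_cases hz : z ∈ U1
  · refine ⟨P, (A1 z hz).1, Or.inl ?_⟩
    filter_upwards [hU1o.mem_nhds hz] with w hw
    exact htau1 w hw
  · refine ⟨Q, (A2 z (h12 z hz)).1, Or.inr ⟨htau2 z hz, hQ0 z hz, ?_⟩⟩
    filter_upwards [hisol z hz, mem_nhdsWithin_of_mem_nhds (hU2o.mem_nhds (h12 z hz))] with w h1 h2
    have hw : w ∈ U1 := by
      by_contra hw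
      exact h1 (hQ0 w hw)
    rw [htau1 w hw, (hPQ w h2 hw).1]

lemma sd_comp (f : ℂ → ℂ) (x : ℂ) (ρ : ℝ) (hρ : 0 < ρ) (v : ℂ)
    (hf : DifferentiableAt ℂ f (x + ρ * v)) :
    DifferentiableAt ℂ (fun v : ℂ => f (x + ρ * v)) v ∧
      sd (fun v : ℂ => f (x + ρ * v)) v = ρ * sd f (x + ρ * v) := by
  have h1 : HasDerivAt (fun v : ℂ => x + ρ * v) (ρ : ℂ) v := by
    simpa using ((hasDerivAt_id v).const_mul (ρ : ℂ)).const_add x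
  have h2 := HasDerivAt.comp (h := fun v : ℂ => x + ρ * v) v hf.hasDerivAt h1
  have h3 : HasDerivAt (fun v : ℂ => f (x + ρ * v)) (deriv f (x + ρ * v) * ρ) v := h2
  refine ⟨h3.differentiableAt, ?_⟩
  unfold sd
  rw [h3.deriv, norm_mul, Complex.norm_real, Real.norm_eq_abs, abs_of_pos hρ]
  ring

theorem zalcman_rescaling
    (Ω : Set ℂ) (hΩ : IsOpen Ω) (hΩc : IsConnected Ω) (a : ℂ) (ha : a ∈ Ω)
    (F : Set (ℂ → ℂ)) (hF : ∀ f ∈ F, DifferentiableOn ℂ f Ω)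
    (hnotnormal : ¬ ∃ U : Set ℂ, IsOpen U ∧ a ∈ U ∧ U ⊆ Ω ∧
      ∀ f : ℕ → ℂ → ℂ, (∀ k, f k ∈ F) →
        ∃ φ : ℕ → ℕ, StrictMono φ ∧ ∃ h : ℂ → OnePoint ℂ,
          ∀ K : Set ℂ, K ⊆ U → IsCompact K → ∀ ε > (0 : ℝ), ∃ M, ∀ j ≥ M, ∀ z ∈ K,
            sdist ((f (φ j) z : ℂ) : OnePoint ℂ) (h z) < ε) :
    ∃ (x : ℕ → ℂ) (ρ : ℕ → ℝ) (f : ℕ → ℂ → ℂ) (g : ℂ → OnePoint ℂ),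
      (∀ j, f j ∈ F) ∧ (∀ j, x j ∈ Ω) ∧ Tendsto x atTop (𝓝 a) ∧
      (∀ j, 0 < ρ j) ∧ Tendsto ρ atTop (𝓝 (0 : ℝ)) ∧
      MeromorphicToSphere g Set.univ ∧ (∃ v w : ℂ, g v ≠ g w) ∧
      ∀ K : Set ℂ, IsCompact K → ∀ ε > (0 : ℝ), ∃ M, ∀ j ≥ M, ∀ v ∈ K,
        x j + ρ j * v ∈ Ω ∧
        sdist ((f j (x j + ρ j * v) : ℂ) : OnePoint ℂ) (g v) < ε := by
  obtain ⟨r₀, hr₀, hseq⟩ := zal_seq Ω hΩ a ha F hF hnotnormal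
  choose f hfF x ρ hxΩ hxa hρ hρr hsd1 hv using hseq
  have hcd : ∀ (n : ℕ) (v : ℂ), ‖v‖ ≤ ((n : ℝ) + 1) / 2 →
      DifferentiableAt ℂ (fun v : ℂ => f n (x n + ρ n * v)) v ∧
      sd (fun v : ℂ => f n (x n + ρ n * v)) v ≤ 2 := by
    intro n v hvn
    obtain ⟨h1, h2⟩ := hv n v hvn
    obtain ⟨h3, h4⟩ := sd_comp (f n) (x n) (ρ n) (hρ n) v
      ((hF _ (hfF n)).differentiableAt (hΩ.mem_nhds h1))
    exact ⟨h3, h4 ▸ h2⟩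
  have hbig : ∀ R : ℝ, ∀ᶠ n : ℕ in atTop, R ≤ ((n : ℝ) + 1) / 2 := by
    intro R
    filter_upwards [eventually_ge_atTop ⌈2 * R⌉₊] with n hn
    have := Nat.ceil_le.1 hn
    linarith
  obtain ⟨φ, hφ, H, hHS, hH⟩ := zal_aa Sph isCompact_Sph
    (fun n z => sig (f n (x n + ρ n * z))) (fun n z => sig_mem _) univ (by
      intro z _ ε hε
      refine ⟨min 1 (ε / 2), by positivity, ?_⟩
      filter_upwards [hbig (‖z‖ + 1)] with n hn w hw
      rw [Metric.mem_ball, lt_min_iff] at hw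
      have hb : ∀ y ∈ Metric.ball z 1, ‖y‖ ≤ ((n : ℝ) + 1) / 2 := by
        intro y hy
        rw [Metric.mem_ball, dist_eq_norm] at hy
        have := norm_le_norm_add_norm_sub' y z
        linarith
      have h1 := zal_lip (fun v : ℂ => f n (x n + ρ n * v)) z 1 2
        (fun y hy => (hcd n y (hb y hy)).1) (fun y hy => (hcd n y (hb y hy)).2) w hw.1
      refine h1.trans ?_
      linarith [hw.2])
  have hm := zal_main (fun n v => f (φ n) (x (φ n) + ρ (φ n) * v)) H (fun z => hHS z (mem_univ z))
    (fun z => hH z (mem_univ z)) (by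
      intro z
      have h1 := (hφ.tendsto_atTop.eventually (hbig (‖z‖ + 1))).prod_mk
        (Metric.ball_mem_nhds z one_pos : ∀ᶠ w in 𝓝 z, w ∈ Metric.ball z 1)
      filter_upwards [h1] with p hp
      refine (hcd (φ p.1) p.2 ?_).1
      have hy : p.2 ∈ Metric.ball z 1 := hp.2
      rw [Metric.mem_ball, dist_eq_norm] at hy
      have := norm_le_norm_add_norm_sub' p.2 z
      linarith [hp.1]) (by
      intro n
      have h0 := hv (φ n) 0 (by rw [norm_zero]; positivity)
      rw [(sd_comp (f (φ n)) (x (φ n)) (ρ (φ n)) (hρ _) 0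
        ((hF _ (hfF _)).differentiableAt (hΩ.mem_nhds h0.1))).2]
      simpa using hsd1 (φ n))
  have hr0 : Tendsto (fun n : ℕ => r₀ / ((n : ℝ) + 1)) atTop (𝓝 0) :=
    tendsto_const_div_atTop_nhds_zero_nat r₀ |>.comp (tendsto_add_atTop_nat 1) |>.congr
      (fun n => by simp)
  refine ⟨fun n => x (φ n), fun n => ρ (φ n), fun n => f (φ n), fun z => tau (H z),
    fun j => hfF _, fun j => hxΩ _, ?_, fun j => hρ _, ?_, hm.1, hm.2, ?_⟩
  · refine Tendsto.comp (g := x) ?_ hφ.tendsto_atTop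
    rw [tendsto_iff_dist_tendsto_zero]
    exact squeeze_zero (fun n => dist_nonneg) hxa hr0
  · exact Tendsto.comp (g := ρ) (squeeze_zero (fun n => (hρ n).le) hρr hr0) hφ.tendsto_atTop
  · intro K hK ε hε
    obtain ⟨M, hM⟩ := zal_unif (fun n v => f (φ n) (x (φ n) + ρ (φ n) * v)) H univ isOpen_univ
      hHS hH K (subset_univ K) hK ε hε
    obtain ⟨R, hR⟩ := hK.isBounded.exists_norm_le
    obtain ⟨N, hN⟩ := eventually_atTop.1 (hφ.tendsto_atTop.eventually (hbig R))
    refine ⟨max M N, fun j hj v hvK => ⟨?_, hM j (le_of_max_le_left hj) v hvK⟩⟩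
    exact (hv (φ j) v ((hR v hvK).trans (hN j (le_of_max_le_right hj)))).1
end
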